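/- Let 1 ≤ p < ∞, let Y be a complex Banach space and let b : ℝ → ℂ be continuous with compact support. Then the operator norm of C_b⊗Id_Y on the Bochner space L^p(ℝ;Y) is at most the lim inf, as n → ∞, of the operator norms of C_{a_n}⊗Id_Y on ℓ^p(ℤ;Y), where a_n = (a_{n,k})_{k∈ℤ}. -/

import Mathlib

open scoped ENNReal
open MeasureTheory

/-- The coefficients `a_{n,k} = ∫₀¹∫₀¹ (1/n)·b((t−s+k)/n) ds dt`. -/
noncomputable def discreteCoeff (b : ℝ → ℂ) (n : ℕ) (k : ℤ) : ℂ :=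
  ∫ t in (0:ℝ)..1, ∫ s in (0:ℝ)..1, (1 / (n : ℂ)) * b ((t - s + (k : ℝ)) / n)


/-- The cell `[k/n, (k+1)/n)`. -/
def cellSet (n : ℕ) (k : ℤ) : Set ℝ := Set.Ico ((k : ℝ) / n) (((k : ℝ) + 1) / n)

theorem mem_cellSet {n : ℕ} (hn : 1 ≤ n) (k : ℤ) (s : ℝ) :
    s ∈ cellSet n k ↔ ⌊(n : ℝ) * s⌋ = k := by
  have h : (0 : ℝ) < n := by exact_mod_cast hn
  rw [Int.floor_eq_iff, cellSet, Set.mem_Ico, div_le_iff₀ h, lt_div_iff₀ h, mul_comm s]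

theorem measurableSet_cellSet (n : ℕ) (k : ℤ) : MeasurableSet (cellSet n k) :=
  measurableSet_Ico

theorem volume_cellSet {n : ℕ} (hn : 1 ≤ n) (k : ℤ) :
    volume (cellSet n k) = (n : ℝ≥0∞)⁻¹ := by
  have h : (0 : ℝ) < n := by exact_mod_cast hn
  rw [cellSet, Real.volume_Ico, ← sub_div, add_sub_cancel_left, ENNReal.ofReal_div_of_pos h]
  simp

theorem lintegral_cells {n : ℕ} (hn : 1 ≤ n) (g : ℝ → ℝ≥0∞) :
    ∫⁻ s, g s = ∑' k : ℤ, ∫⁻ s in cellSet n k, g s := by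
  rw [← lintegral_iUnion (measurableSet_cellSet n)]
  · have : (⋃ k, cellSet n k) = Set.univ := by
      ext s
      simp [mem_cellSet hn]
    rw [this, Measure.restrict_univ]
  · intro i j hij
    rw [Function.onFun, Set.disjoint_left]
    intro s hs hs'
    rw [mem_cellSet hn] at hs hs'
    exact hij (hs.symm.trans hs')

section
variable {p : ℝ≥0∞} {Y : Type*} [NormedAddCommGroup Y] [hp1F : Fact (1 ≤ p)]

theorem eLpNorm_rpow_eq (hq : 0 < p.toReal) (hp : p ≠ ∞) (f : ℝ → Y) (μ : Measure ℝ) :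
    eLpNorm f p μ ^ p.toReal = ∫⁻ s, ‖f s‖ₑ ^ p.toReal ∂μ := by
  have h0 : p ≠ 0 := by rintro rfl; simp at hq
  rw [eLpNorm_eq_lintegral_rpow_enorm_toReal h0 hp, ← ENNReal.rpow_mul, one_div,
    inv_mul_cancel₀ hq.ne', ENNReal.rpow_one]

theorem tsum_enorm_rpow_eq (hq : 0 < p.toReal) (u : lp (fun _ : ℤ => Y) p) :
    ∑' k : ℤ, ‖u k‖ₑ ^ p.toReal = ‖u‖ₑ ^ p.toReal := by
  have hs := (memℓp_gen_iff hq).1 (lp.memℓp u)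
  have h := ENNReal.ofReal_tsum_of_nonneg (fun k => by positivity) hs
  rw [← lp.norm_rpow_eq_tsum hq, ← ENNReal.ofReal_rpow_of_nonneg (norm_nonneg _) hq.le,
    ofReal_norm] at h
  rw [h]
  refine tsum_congr fun k => ?_
  rw [← ENNReal.ofReal_rpow_of_nonneg (norm_nonneg _) hq.le, ofReal_norm]

theorem eLpNorm_step (hq : 0 < p.toReal) (hp : p ≠ ∞) {n : ℕ} (hn : 1 ≤ n)
    (u : lp (fun _ : ℤ => Y) p) :
    eLpNorm (fun s : ℝ => (u : ℤ → Y) ⌊(n : ℝ) * s⌋) p volume ^ p.toReal =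
      (n : ℝ≥0∞)⁻¹ * ‖u‖ₑ ^ p.toReal := by
  rw [eLpNorm_rpow_eq hq hp, lintegral_cells hn, ← tsum_enorm_rpow_eq hq, ← ENNReal.tsum_mul_left]
  refine tsum_congr fun k => ?_
  rw [setLIntegral_congr_fun (g := fun _ => ‖u k‖ₑ ^ p.toReal) (measurableSet_cellSet n k),
    lintegral_const, Measure.restrict_apply_univ, volume_cellSet hn, mul_comm]
  intro s hs
  simp only [(mem_cellSet hn k s).1 hs]

theorem memLp_step (hq : 0 < p.toReal) (hp : p ≠ ∞) {n : ℕ} (hn : 1 ≤ n)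
    (u : lp (fun _ : ℤ => Y) p) :
    MemLp (fun s : ℝ => (u : ℤ → Y) ⌊(n : ℝ) * s⌋) p volume := by
  refine ⟨?_, ?_⟩
  · have h1 : StronglyMeasurable (u : ℤ → Y) := StronglyMeasurable.of_discrete
    exact (h1.comp_measurable (by fun_prop : Measurable fun s : ℝ => ⌊(n : ℝ) * s⌋)).aestronglyMeasurable
  · have h := eLpNorm_step hq hp hn u
    have hn0 : (n : ℝ≥0∞) ≠ 0 := by exact_mod_cast (by omega : n ≠ 0)
    rw [← ENNReal.rpow_lt_top_iff_of_pos hq, h]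
    exact ENNReal.mul_lt_top (by simp; omega) (by
      rw [ENNReal.rpow_lt_top_iff_of_pos hq]; exact enorm_lt_top)

theorem exists_step [NormedSpace ℂ Y] (hq : 0 < p.toReal) (hp : p ≠ ∞)
    {n : ℕ} (hn : 1 ≤ n) :
    ∃ E : lp (fun _ : ℤ => Y) p →L[ℂ] Lp Y p (volume : Measure ℝ),
      (∀ u, (E u : ℝ → Y) =ᵐ[volume] fun s => (u : ℤ → Y) ⌊(n : ℝ) * s⌋) ∧
      ∀ u, ‖E u‖ ≤ ((n : ℝ) ^ p.toReal⁻¹)⁻¹ * ‖u‖ := by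
  have hnr : (0 : ℝ) < n := by exact_mod_cast hn
  have hn0 : (n : ℝ≥0∞) ≠ 0 := by exact_mod_cast (by omega : n ≠ 0)
  let L : lp (fun _ : ℤ => Y) p →ₗ[ℂ] Lp Y p (volume : Measure ℝ) :=
    { toFun := fun u => (memLp_step hq hp hn u).toLp _
      map_add' := fun u v => by
        rw [← MemLp.toLp_add]; rfl
      map_smul' := fun c u => by
        rw [RingHom.id_apply, ← MemLp.toLp_const_smul]; rfl }
  have hL : ∀ u, ‖L u‖ ≤ ((n : ℝ) ^ p.toReal⁻¹)⁻¹ * ‖u‖ := by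
    intro u
    have h := eLpNorm_step hq hp hn u
    have h2 : ‖L u‖ = (eLpNorm (fun s : ℝ => (u : ℤ → Y) ⌊(n : ℝ) * s⌋) p volume).toReal :=
      Lp.norm_toLp _ (memLp_step hq hp hn u)
    have h3 := congrArg ENNReal.toReal h
    rw [← ENNReal.toReal_rpow, ← h2, ENNReal.toReal_mul, ← ENNReal.toReal_rpow, toReal_enorm,
      ENNReal.toReal_inv, ENNReal.toReal_natCast] at h3
    rw [← Real.rpow_le_rpow_iff (norm_nonneg _) (by positivity) hq, h3,
      Real.mul_rpow (by positivity) (by positivity), Real.inv_rpow (by positivity),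
      ← Real.rpow_mul hnr.le, inv_mul_cancel₀ hq.ne', Real.rpow_one]
  exact ⟨L.mkContinuous _ hL, fun u => MemLp.coeFn_toLp (memLp_step hq hp hn u), hL⟩

theorem enorm_avg_rpow_le [NormedSpace ℝ Y] (hp1 : 1 ≤ p) (hq : 0 < p.toReal)
    (hp : p ≠ ∞) {n : ℕ} (hn : 1 ≤ n) {f : ℝ → Y} (hf : AEStronglyMeasurable f volume) (k : ℤ) :
    ‖(n : ℝ) • ∫ s in cellSet n k, f s‖ₑ ^ p.toReal
      ≤ n * ∫⁻ s in cellSet n k, ‖f s‖ₑ ^ p.toReal := by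
  have hn0 : (n : ℝ≥0∞) ≠ 0 := by exact_mod_cast (by omega : n ≠ 0)
  have hnt : (n : ℝ≥0∞) ≠ ∞ := by simp
  have h1 : ‖∫ s in cellSet n k, f s‖ₑ ≤ eLpNorm f p (volume.restrict (cellSet n k)) *
      ((n : ℝ≥0∞)⁻¹) ^ (1 - p.toReal⁻¹) := by
    refine (enorm_integral_le_lintegral_enorm _).trans ?_
    rw [← eLpNorm_one_eq_lintegral_enorm]
    refine (eLpNorm_le_eLpNorm_mul_rpow_measure_univ hp1 hf.restrict).trans_eq ?_
    rw [Measure.restrict_apply_univ, volume_cellSet hn]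
    simp
  have h2 : ‖(n : ℝ) • ∫ s in cellSet n k, f s‖ₑ ≤
      (n : ℝ≥0∞) ^ p.toReal⁻¹ * eLpNorm f p (volume.restrict (cellSet n k)) := by
    rw [enorm_smul]
    have : ‖(n : ℝ)‖ₑ = n := by simp
    rw [this]
    refine (mul_le_mul_right h1 _).trans_eq ?_
    rw [mul_left_comm, mul_comm]
    congr 1
    nth_rewrite 1 [← ENNReal.rpow_one (n : ℝ≥0∞)]
    rw [← ENNReal.rpow_neg_one, ← ENNReal.rpow_mul, ← ENNReal.rpow_add _ _ hn0 hnt]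
    congr 1; ring
  refine (ENNReal.rpow_le_rpow h2 hq.le).trans_eq ?_
  rw [ENNReal.mul_rpow_of_nonneg _ _ hq.le, ← ENNReal.rpow_mul, inv_mul_cancel₀ hq.ne',
    ENNReal.rpow_one, eLpNorm_rpow_eq hq hp]

theorem tsum_avg_le [NormedSpace ℝ Y] (hp1 : 1 ≤ p) (hq : 0 < p.toReal)
    (hp : p ≠ ∞) {n : ℕ} (hn : 1 ≤ n) {f : ℝ → Y} (hf : AEStronglyMeasurable f volume) :
    ∑' k : ℤ, ‖(n : ℝ) • ∫ s in cellSet n k, f s‖ₑ ^ p.toReal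
      ≤ n * eLpNorm f p volume ^ p.toReal := by
  rw [eLpNorm_rpow_eq hq hp, lintegral_cells hn, ← ENNReal.tsum_mul_left]
  exact ENNReal.tsum_le_tsum fun k => enorm_avg_rpow_le hp1 hq hp hn hf k

theorem memlp_avg [NormedSpace ℝ Y] (hp1 : 1 ≤ p) (hq : 0 < p.toReal)
    (hp : p ≠ ∞) {n : ℕ} (hn : 1 ≤ n) {f : ℝ → Y} (hf : MemLp f p volume) :
    Memℓp (fun k : ℤ => (n : ℝ) • ∫ s in cellSet n k, f s) p := by
  have h := tsum_avg_le hp1 hq hp hn hf.1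
  refine memℓp_gen ?_
  have hne : ∑' k : ℤ, ‖(n : ℝ) • ∫ s in cellSet n k, f s‖ₑ ^ p.toReal ≠ ∞ := by
    refine ne_top_of_le_ne_top ?_ h
    exact ENNReal.mul_ne_top (by simp) (ENNReal.rpow_ne_top_of_nonneg hq.le hf.2.ne)
  have := ENNReal.summable_toReal hne
  simpa only [← ENNReal.toReal_rpow, toReal_enorm] using this

theorem integrableOn_cell {n : ℕ} (f : Lp Y p (volume : Measure ℝ)) (k : ℤ) :
    IntegrableOn (f : ℝ → Y) (cellSet n k) volume := by
  have : IsFiniteMeasure (volume.restrict (cellSet n k)) := by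
    unfold cellSet; infer_instance
  exact ((Lp.memLp f).restrict _).integrable (Fact.out)

theorem exists_avg [NormedSpace ℂ Y] (hq : 0 < p.toReal) (hp : p ≠ ∞)
    {n : ℕ} (hn : 1 ≤ n) :
    ∃ P : Lp Y p (volume : Measure ℝ) →L[ℂ] lp (fun _ : ℤ => Y) p,
      (∀ f k, (P f : ℤ → Y) k = (n : ℝ) • ∫ s in cellSet n k, (f : ℝ → Y) s) ∧
      ∀ f, ‖P f‖ ≤ (n : ℝ) ^ p.toReal⁻¹ * ‖f‖ := by
  have hnr : (0 : ℝ) < n := by exact_mod_cast hn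
  have hp1 : 1 ≤ p := Fact.out
  let L : Lp Y p (volume : Measure ℝ) →ₗ[ℂ] lp (fun _ : ℤ => Y) p :=
    { toFun := fun f => ⟨fun k : ℤ => (n : ℝ) • ∫ s in cellSet n k, (f : ℝ → Y) s,
        memlp_avg hp1 hq hp hn (Lp.memLp f)⟩
      map_add' := fun f g => by
        ext k
        simp only [lp.coeFn_add, Pi.add_apply]
        rw [← smul_add, ← integral_add (integrableOn_cell f k) (integrableOn_cell g k)]
        congr 1
        exact integral_congr_ae (ae_restrict_of_ae (Lp.coeFn_add f g))
      map_smul' := fun c f => by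
        ext k
        simp only [lp.coeFn_smul, Pi.smul_apply, RingHom.id_apply]
        rw [smul_comm c (n : ℝ), ← integral_smul c]
        congr 1
        exact integral_congr_ae (ae_restrict_of_ae (Lp.coeFn_smul c f)) }
  have hL : ∀ f, ‖L f‖ ≤ (n : ℝ) ^ p.toReal⁻¹ * ‖f‖ := by
    intro f
    have h : ∑' k : ℤ, ‖(L f : ℤ → Y) k‖ₑ ^ p.toReal ≤ n * eLpNorm f p volume ^ p.toReal :=
      tsum_avg_le hp1 hq hp hn (Lp.memLp f).1
    rw [tsum_enorm_rpow_eq hq] at h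
    have h3 := ENNReal.toReal_mono (ENNReal.mul_ne_top (by simp)
      (ENNReal.rpow_ne_top_of_nonneg hq.le (Lp.memLp f).2.ne)) h
    rw [← ENNReal.toReal_rpow, ENNReal.toReal_mul, ← ENNReal.toReal_rpow, toReal_enorm,
      ENNReal.toReal_natCast, ← Lp.norm_def] at h3
    rw [← Real.rpow_le_rpow_iff (norm_nonneg _) (by positivity) hq,
      Real.mul_rpow (by positivity) (by positivity),
      ← Real.rpow_mul hnr.le, inv_mul_cancel₀ hq.ne', Real.rpow_one]
    exact h3
  exact ⟨L.mkContinuous _ hL, fun f k => rfl, hL⟩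

end

theorem abstract_liminf {X : Type*} {Z : Type*} [NormedAddCommGroup X] [NormedSpace ℂ X]
    [NormedAddCommGroup Z] [NormedSpace ℂ Z] (C : X →L[ℂ] X) (D : ℕ → (Z →L[ℂ] Z))
    (E : ℕ → (Z →L[ℂ] X)) (P : ℕ → (X →L[ℂ] Z)) (β : ℕ → ℝ) (hβ : ∀ n, 1 ≤ n → 0 < β n)
    (hE : ∀ n, 1 ≤ n → ∀ z, ‖E n z‖ ≤ (β n)⁻¹ * ‖z‖)
    (hP : ∀ n, 1 ≤ n → ∀ x, ‖P n x‖ ≤ β n * ‖x‖)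
    (hEP : ∀ x, Filter.Tendsto (fun n => E n (P n x)) Filter.atTop (nhds x))
    (hD : ∀ n, 1 ≤ n → ∀ z, D n z = P n (C (E n z))) :
    ‖C‖ ≤ Filter.liminf (fun n => ‖D n‖) Filter.atTop := by
  have hcob : Filter.IsCoboundedUnder (· ≥ ·) Filter.atTop (fun n => ‖D n‖) := by
    refine Filter.IsBoundedUnder.isCoboundedUnder_ge ?_
    refine ⟨‖C‖, ?_⟩
    rw [Filter.eventually_map]
    filter_upwards [Filter.eventually_ge_atTop 1] with n hn
    refine ContinuousLinearMap.opNorm_le_bound _ (norm_nonneg _) fun z => ?_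
    have hb := hβ n hn
    rw [hD n hn]
    calc ‖P n (C (E n z))‖ ≤ β n * (‖C‖ * ((β n)⁻¹ * ‖z‖)) := by
          refine (hP n hn _).trans ?_
          gcongr
          refine (C.le_opNorm _).trans ?_
          gcongr
          exact hE n hn z
      _ = ‖C‖ * ‖z‖ := by field_simp
  -- contraction
  have hA : ∀ n, 1 ≤ n → ∀ x, ‖E n (P n x)‖ ≤ ‖x‖ := by
    intro n hn x
    have hb := hβ n hn
    calc ‖E n (P n x)‖ ≤ (β n)⁻¹ * (β n * ‖x‖) := by
          refine (hE n hn _).trans ?_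
          gcongr
          exact hP n hn x
      _ = ‖x‖ := by field_simp
  -- strong convergence
  have hconv : ∀ x, Filter.Tendsto (fun n => E n (D n (P n x))) Filter.atTop (nhds (C x)) := by
    intro x
    have h1 : Filter.Tendsto (fun n => E n (P n (C (E n (P n x) - x)))) Filter.atTop (nhds 0) := by
      have h2 : Filter.Tendsto (fun n => ‖C (E n (P n x) - x)‖) Filter.atTop (nhds 0) := by
        have := ((C.continuous.tendsto _).comp ((hEP x).sub_const x)).norm
        simpa using this
      refine squeeze_zero_norm' ?_ h2
      filter_upwards [Filter.eventually_ge_atTop 1] with n hn using hA n hn _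
    have h3 := h1.add (hEP (C x))
    rw [zero_add] at h3
    refine h3.congr' ?_
    filter_upwards [Filter.eventually_ge_atTop 1] with n hn
    rw [hD n hn, ← map_add, ← map_add, ← map_add, sub_add_cancel]
  refine le_of_forall_lt fun a ha => ?_
  obtain ⟨c, hac, hc⟩ := exists_between ha
  refine hac.trans_le (Filter.le_liminf_of_le hcob ?_)
  obtain ⟨x, hx1, hx⟩ := C.exists_lt_apply_of_lt_opNorm hc
  filter_upwards [Filter.eventually_ge_atTop 1, (hconv x).norm.eventually_const_lt hx]
    with n hn hlt
  have hb := hβ n hn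
  refine hlt.le.trans ?_
  calc ‖E n (D n (P n x))‖ ≤ (β n)⁻¹ * (‖D n‖ * (β n * ‖x‖)) := by
        refine (hE n hn _).trans ?_
        gcongr
        refine ((D n).le_opNorm _).trans ?_
        gcongr
        exact hP n hn x
    _ = ‖D n‖ * ‖x‖ := by field_simp
    _ ≤ ‖D n‖ * 1 := by gcongr
    _ = ‖D n‖ := mul_one _

section
variable {p : ℝ≥0∞} {Y : Type*} [NormedAddCommGroup Y] [hp1F : Fact (1 ≤ p)]
  [NormedSpace ℂ Y] [CompleteSpace Y]

theorem dist_of_mem_cellSet {n : ℕ} (hn : 1 ≤ n) {k : ℤ} {s t : ℝ} (hs : s ∈ cellSet n k)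
    (ht : t ∈ cellSet n k) : |t - s| ≤ 1 / n := by
  have h : (0 : ℝ) < n := by exact_mod_cast hn
  obtain ⟨h1, h2⟩ := hs
  obtain ⟨h3, h4⟩ := ht
  rw [add_div] at h2 h4
  rw [abs_le]
  constructor <;> linarith

theorem step_avg_close (hp : p ≠ ∞) {n : ℕ} (hn : 1 ≤ n)
    (E : lp (fun _ : ℤ => Y) p →L[ℂ] Lp Y p (volume : Measure ℝ))
    (hE : ∀ u, (E u : ℝ → Y) =ᵐ[volume] fun s => (u : ℤ → Y) ⌊(n : ℝ) * s⌋)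
    (P : Lp Y p (volume : Measure ℝ) →L[ℂ] lp (fun _ : ℤ => Y) p)
    (hP : ∀ f k, (P f : ℤ → Y) k = (n : ℝ) • ∫ s in cellSet n k, (f : ℝ → Y) s)
    {g : ℝ → Y} (hgc : Continuous g) (hg : MemLp g p volume) {ε R : ℝ}
    (hε : ∀ x y, |x - y| ≤ 1 / (n : ℝ) → ‖g x - g y‖ ≤ ε)
    (hR : ∀ x, R < |x| → g x = 0) :
    ‖E (P (hg.toLp g)) - hg.toLp g‖ₑ ≤
      (ENNReal.ofReal (2 * (R + 1))) ^ p.toReal⁻¹ * ENNReal.ofReal ε := by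
  have hnr : (0 : ℝ) < n := by exact_mod_cast hn
  have hn1 : (1 : ℝ) / n ≤ 1 := by
    rw [div_le_one hnr]; exact_mod_cast hn
  let h : ℝ → Y := fun s => (n : ℝ) • ∫ t in cellSet n ⌊(n : ℝ) * s⌋, (g t - g s)
  have hvol : ∀ k, volume.real (cellSet n k) = (n : ℝ)⁻¹ := by
    intro k
    simp [Measure.real, volume_cellSet hn k]
  have hfin : ∀ k, volume (cellSet n k) < ∞ := by
    intro k
    rw [volume_cellSet hn k]; simp; omega
  have hae : ((E (P (hg.toLp g)) - hg.toLp g : Lp Y p volume) : ℝ → Y) =ᵐ[volume] h := by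
    filter_upwards [Lp.coeFn_sub (E (P (hg.toLp g))) (hg.toLp g), hE (P (hg.toLp g)),
      hg.coeFn_toLp] with s h1 h2 h3
    rw [h1, Pi.sub_apply, h2, h3, hP]
    simp only [h]
    have hgi : IntegrableOn g (cellSet n ⌊(n : ℝ) * s⌋) volume :=
      (hgc.integrableOn_Icc).mono_set Set.Ico_subset_Icc_self
    rw [integral_sub hgi (integrableOn_const (hfin _).ne enorm_ne_top), setIntegral_const, hvol, smul_sub,
      smul_smul, mul_inv_cancel₀ hnr.ne', one_smul]
    congr 2
    exact integral_congr_ae (ae_restrict_of_ae hg.coeFn_toLp)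
  have hmem : ∀ s : ℝ, s ∈ cellSet n ⌊(n : ℝ) * s⌋ := fun s => (mem_cellSet hn _ s).2 rfl
  have hbd : ∀ s, ‖h s‖ ≤ ε := by
    intro s
    simp only [h]
    have := norm_setIntegral_le_of_norm_le_const (μ := volume) (f := fun t => g t - g s) (C := ε)
      (hfin ⌊(n : ℝ) * s⌋) (fun t ht => hε _ _ (dist_of_mem_cellSet hn (hmem s) ht))
    rw [hvol] at this
    rw [norm_smul, Real.norm_of_nonneg hnr.le]
    calc (n : ℝ) * _ ≤ n * (ε * (n : ℝ)⁻¹) := by gcongr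
      _ = ε := by field_simp
  have hsupp : Function.support h ⊆ Set.Icc (-(R + 1)) (R + 1) := by
    intro s hs
    by_contra hcon
    apply hs
    have hs' : R + 1 < |s| := by
      rw [← abs_le.trans Set.mem_Icc.symm] at hcon
      exact not_le.1 hcon
    simp only [h]
    rw [setIntegral_eq_zero_of_forall_eq_zero, smul_zero]
    intro t ht
    have hd := dist_of_mem_cellSet hn (hmem s) ht
    have h5 : |s| ≤ |t| + |t - s| := by
      have := abs_sub t (t - s)
      simpa using this
    rw [hR t (by linarith), hR s (by linarith), sub_zero]
  rw [Lp.enorm_def, eLpNorm_congr_ae hae, ← eLpNorm_restrict_eq_of_support_subset hsupp]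
  refine (eLpNorm_le_of_ae_bound (Filter.Eventually.of_forall hbd)).trans_eq ?_
  rw [Measure.restrict_apply_univ, Real.volume_Icc]
  congr 3
  ring

theorem step_avg_tendsto (hp : p ≠ ∞) 
    (E : ℕ → (lp (fun _ : ℤ => Y) p →L[ℂ] Lp Y p (volume : Measure ℝ)))
    (hE : ∀ n : ℕ, 1 ≤ n → ∀ u, (E n u : ℝ → Y) =ᵐ[volume] fun s => (u : ℤ → Y) ⌊(n : ℝ) * s⌋)
    (P : ℕ → (Lp Y p (volume : Measure ℝ) →L[ℂ] lp (fun _ : ℤ => Y) p))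
    (hP : ∀ n : ℕ, 1 ≤ n →
      ∀ f k, (P n f : ℤ → Y) k = (n : ℝ) • ∫ s in cellSet n k, (f : ℝ → Y) s)
    (hA : ∀ n : ℕ, 1 ≤ n → ∀ f, ‖E n (P n f)‖ ≤ ‖f‖) (f : Lp Y p (volume : Measure ℝ)) :
    Filter.Tendsto (fun n => E n (P n f)) Filter.atTop (nhds f) := by
  have hq0 : 0 ≤ p.toReal⁻¹ := by positivity
  -- continuous compactly supported functions
  have key : ∀ (g : ℝ → Y) (hg : MemLp g p volume), Continuous g → HasCompactSupport g →
      Filter.Tendsto (fun n => E n (P n (hg.toLp g)) - hg.toLp g) Filter.atTop (nhds 0) := by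
    intro g hg hgc hgs
    obtain ⟨R, hR⟩ : ∃ R : ℝ, ∀ x, R < |x| → g x = 0 := by
      obtain ⟨R, hR⟩ := hgs.isCompact.isBounded.subset_closedBall (0 : ℝ)
      refine ⟨R, fun x hx => ?_⟩
      by_contra hne
      have := hR (subset_tsupport g hne)
      rw [Metric.mem_closedBall, Real.dist_eq, sub_zero] at this
      linarith
    have huc : UniformContinuous g := hgs.uniformContinuous_of_continuous hgc
    set K : ℝ := (ENNReal.ofReal (2 * (R + 1)) ^ p.toReal⁻¹).toReal with hK
    have hK0 : 0 ≤ K := ENNReal.toReal_nonneg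
    have hKne : ENNReal.ofReal (2 * (R + 1)) ^ p.toReal⁻¹ ≠ ∞ :=
      ENNReal.rpow_ne_top_of_nonneg hq0 ENNReal.ofReal_ne_top
    rw [Metric.tendsto_atTop]
    intro ε hε
    have hη : 0 < ε / (K + 1) := by positivity
    obtain ⟨δ, hδ, hδ'⟩ := Metric.uniformContinuous_iff.1 huc (ε / (K + 1)) hη
    obtain ⟨N, hN⟩ := exists_nat_one_div_lt hδ
    refine ⟨N + 1, fun n hn => ?_⟩
    have hn1 : 1 ≤ n := by omega
    have h1n : (1 : ℝ) / n < δ := by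
      refine lt_of_le_of_lt ?_ hN
      apply one_div_le_one_div_of_le (by positivity)
      exact_mod_cast hn
    have h := step_avg_close hp hn1 (E n) (hE n hn1) (P n) (hP n hn1) hgc hg
      (ε := ε / (K + 1)) (R := R)
      (fun x y hxy => by
        rw [← dist_eq_norm]
        exact (hδ' (by rw [Real.dist_eq]; linarith)).le) hR
    have h2 := ENNReal.toReal_mono (ENNReal.mul_ne_top hKne ENNReal.ofReal_ne_top) h
    rw [toReal_enorm, ENNReal.toReal_mul, ← hK, ENNReal.toReal_ofReal hη.le] at h2
    rw [dist_zero_right]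
    refine h2.trans_lt ?_
    rw [← mul_div_assoc, div_lt_iff₀ (by positivity)]
    nlinarith
  rw [Metric.tendsto_atTop]
  intro ε hε
  obtain ⟨g, hgs, hfg, hgc, hg⟩ := (Lp.memLp f).exists_hasCompactSupport_eLpNorm_sub_le hp
    (ε := ENNReal.ofReal (ε / 4)) (by simpa using by positivity)
  have hfG : ‖f - hg.toLp g‖ ≤ ε / 4 := by
    rw [Lp.norm_def]
    refine ENNReal.toReal_le_of_le_ofReal (by positivity) ?_
    refine (eLpNorm_congr_ae ?_).trans_le hfg
    filter_upwards [Lp.coeFn_sub f (hg.toLp g), hg.coeFn_toLp] with s h1 h2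
    rw [h1, Pi.sub_apply, Pi.sub_apply, h2]
  obtain ⟨N, hN⟩ := Metric.tendsto_atTop.1 (key g hg hgc hgs) (ε / 4) (by positivity)
  refine ⟨N + 1, fun n hn => ?_⟩
  have hn1 : 1 ≤ n := by omega
  have h1 := hN n (by omega)
  rw [dist_zero_right] at h1
  have h2 := hA n hn1 (f - hg.toLp g)
  have hsplit : E n (P n f) - f = E n (P n (f - hg.toLp g)) +
      (E n (P n (hg.toLp g)) - hg.toLp g) - (f - hg.toLp g) := by
    rw [map_sub, map_sub]; abel
  rw [dist_eq_norm, hsplit]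
  have h3 := norm_sub_le (E n (P n (f - hg.toLp g)) + (E n (P n (hg.toLp g)) - hg.toLp g))
    (f - hg.toLp g)
  have h4 := norm_add_le (E n (P n (f - hg.toLp g))) (E n (P n (hg.toLp g)) - hg.toLp g)
  linarith

theorem discreteCoeff_eq (b : ℝ → ℂ) {n : ℕ} (hn : 1 ≤ n) (k j : ℤ) :
    discreteCoeff b n (k - j) =
      (n : ℝ) • ∫ t in cellSet n k, ∫ s in cellSet n j, b (t - s) := by
  have hnr : (n : ℝ) ≠ 0 := by exact_mod_cast (by omega : n ≠ 0)
  have hnp : (0 : ℝ) < n := by exact_mod_cast hn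
  have cell : ∀ (k : ℤ) (F : ℝ → ℂ), ∫ t in cellSet n k, F t =
      (n : ℝ)⁻¹ • ∫ t in (0:ℝ)..1, F (t / n + k / n) := by
    intro k F
    rw [intervalIntegral.integral_comp_div_add F hnr, smul_smul, inv_mul_cancel₀ hnr, one_smul,
      intervalIntegral.integral_of_le (by gcongr; norm_num), cellSet, integral_Ico_eq_integral_Ioc]
    congr 3
    · simp
    · ring
  rw [cell k, smul_smul, mul_inv_cancel₀ hnr, one_smul, discreteCoeff]
  congr 1
  ext t
  rw [cell j, intervalIntegral.integral_const_mul, Complex.real_smul]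
  push_cast
  rw [one_div]
  congr 2
  ext s
  congr 1
  push_cast
  ring

theorem compress_eq (hp : p ≠ ∞) (b : ℝ → ℂ)
    (Cb : Lp Y p (volume : Measure ℝ) →L[ℂ] Lp Y p (volume : Measure ℝ))
    (hCb : ∀ f : Lp Y p (volume : Measure ℝ),
      ∀ᵐ s : ℝ, (Cb f : ℝ → Y) s = ∫ t : ℝ, b t • (f : ℝ → Y) (s - t))
    {n : ℕ} (hn : 1 ≤ n)
    (Ca : lp (fun _ : ℤ => Y) p →L[ℂ] lp (fun _ : ℤ => Y) p)
    (hCa : ∀ (u : lp (fun _ : ℤ => Y) p) (k : ℤ),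
      (Ca u : ∀ _ : ℤ, Y) k = ∑' j : ℤ, discreteCoeff b n (k - j) • (u : ∀ _ : ℤ, Y) j)
    (E : lp (fun _ : ℤ => Y) p →L[ℂ] Lp Y p (volume : Measure ℝ))
    (hE : ∀ u, (E u : ℝ → Y) =ᵐ[volume] fun s => (u : ℤ → Y) ⌊(n : ℝ) * s⌋)
    (P : Lp Y p (volume : Measure ℝ) →L[ℂ] lp (fun _ : ℤ => Y) p)
    (hP : ∀ f k, (P f : ℤ → Y) k = (n : ℝ) • ∫ s in cellSet n k, (f : ℝ → Y) s) :
    Ca = P ∘L (Cb ∘L E) := by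
  refine lp.ext_continuousLinearMap hp fun j => ?_
  ext y k
  simp only [ContinuousLinearMap.comp_apply, lp.singleContinuousLinearMap_apply]
  rw [hCa, hP, tsum_eq_single j, lp.single_apply_self]
  swap
  · intro i hi
    rw [lp.single_apply_ne _ _ _ hi, smul_zero]
  have h1 : ∀ t : ℝ, ∫ τ : ℝ, b τ • (E (lp.single p j y) : ℝ → Y) (t - τ) =
      (∫ s in cellSet n j, b (t - s)) • y := by
    intro t
    rw [← integral_sub_left_eq_self _ volume t]
    simp only [sub_sub_cancel]
    rw [← integral_smul_const, ← integral_indicator (measurableSet_cellSet n j)]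
    refine integral_congr_ae ?_
    filter_upwards [hE (lp.single p j y)] with s hs
    rw [hs]
    by_cases hm : s ∈ cellSet n j
    · rw [Set.indicator_of_mem hm, (mem_cellSet hn j s).1 hm, lp.single_apply_self]
    · rw [Set.indicator_of_notMem hm, lp.single_apply_ne, smul_zero]
      rwa [mem_cellSet hn] at hm
  have h2 : ∫ t in cellSet n k, (Cb (E (lp.single p j y)) : ℝ → Y) t =
      (∫ t in cellSet n k, ∫ s in cellSet n j, b (t - s)) • y := by
    rw [← integral_smul_const]
    refine integral_congr_ae (ae_restrict_of_ae ?_)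
    filter_upwards [hCb (E (lp.single p j y))] with t ht
    rw [ht, h1]
  rw [h2, discreteCoeff_eq b hn, smul_assoc]

end

/-- Let `1 ≤ p < ∞`, let `Y` be a complex Banach space and let
`b : ℝ → ℂ` be continuous with compact support.  Then the operator norm of `C_b ⊗ Id_Y`
on the Bochner space `L^p(ℝ; Y)` is at most the `liminf`, as `n → ∞`, of the operator
norms of `C_{a_n} ⊗ Id_Y` on `ℓ^p(ℤ; Y)`. -/
theorem conv_norm_le_liminf_discrete_conv_norm (p : ℝ≥0∞) [Fact (1 ≤ p)] (hp : p ≠ ∞)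
    (Y : Type*) [NormedAddCommGroup Y] [NormedSpace ℂ Y] [CompleteSpace Y]
    (b : ℝ → ℂ) (hb : Continuous b) (hb' : HasCompactSupport b)
    (Cb : Lp Y p (volume : Measure ℝ) →L[ℂ] Lp Y p (volume : Measure ℝ))
    (hCb : ∀ f : Lp Y p (volume : Measure ℝ),
      ∀ᵐ s : ℝ, (Cb f : ℝ → Y) s = ∫ t : ℝ, b t • (f : ℝ → Y) (s - t))
    (Ca : ℕ → (lp (fun _ : ℤ => Y) p →L[ℂ] lp (fun _ : ℤ => Y) p))
    (hCa : ∀ (n : ℕ), 1 ≤ n → ∀ (u : lp (fun _ : ℤ => Y) p) (k : ℤ),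
      (Ca n u : ∀ _ : ℤ, Y) k = ∑' j : ℤ, discreteCoeff b n (k - j) • (u : ∀ _ : ℤ, Y) j) :
    ‖Cb‖ ≤ Filter.liminf (fun n : ℕ => ‖Ca n‖) Filter.atTop := by
  have hp1 : 1 ≤ p := Fact.out
  have hq : 0 < p.toReal := ENNReal.toReal_pos (zero_lt_one.trans_le hp1).ne' hp
  have hex : ∀ n : ℕ, ∃ E : lp (fun _ : ℤ => Y) p →L[ℂ] Lp Y p (volume : Measure ℝ), 1 ≤ n →
      (∀ u, (E u : ℝ → Y) =ᵐ[volume] fun s => (u : ℤ → Y) ⌊(n : ℝ) * s⌋) ∧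
      ∀ u, ‖E u‖ ≤ ((n : ℝ) ^ p.toReal⁻¹)⁻¹ * ‖u‖ := by
    intro n
    by_cases hn : 1 ≤ n
    · obtain ⟨E, hE⟩ := exists_step (Y := Y) hq hp hn
      exact ⟨E, fun _ => hE⟩
    · exact ⟨0, fun h => absurd h hn⟩
  have hpx : ∀ n : ℕ, ∃ P : Lp Y p (volume : Measure ℝ) →L[ℂ] lp (fun _ : ℤ => Y) p, 1 ≤ n →
      (∀ f k, (P f : ℤ → Y) k = (n : ℝ) • ∫ s in cellSet n k, (f : ℝ → Y) s) ∧
      ∀ f, ‖P f‖ ≤ (n : ℝ) ^ p.toReal⁻¹ * ‖f‖ := by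
    intro n
    by_cases hn : 1 ≤ n
    · obtain ⟨P, hP⟩ := exists_avg (Y := Y) hq hp hn
      exact ⟨P, fun _ => hP⟩
    · exact ⟨0, fun h => absurd h hn⟩
  choose E hE using hex
  choose P hP using hpx
  have hβ : ∀ n : ℕ, 1 ≤ n → 0 < (n : ℝ) ^ p.toReal⁻¹ := fun n hn =>
    Real.rpow_pos_of_pos (by exact_mod_cast hn) _
  refine abstract_liminf Cb Ca E P (fun n => (n : ℝ) ^ p.toReal⁻¹) hβ
    (fun n hn => (hE n hn).2) (fun n hn => (hP n hn).2) ?_ ?_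
  · refine step_avg_tendsto hp E (fun n hn => (hE n hn).1) P (fun n hn => (hP n hn).1) ?_
    intro n hn f
    have hb := hβ n hn
    calc ‖E n (P n f)‖ ≤ ((n : ℝ) ^ p.toReal⁻¹)⁻¹ * ((n : ℝ) ^ p.toReal⁻¹ * ‖f‖) := by
          refine ((hE n hn).2 _).trans ?_
          gcongr
          exact (hP n hn).2 f
      _ = ‖f‖ := by field_simp
  · intro n hn z
    rw [compress_eq hp b Cb hCb hn (Ca n) (hCa n hn) (E n) (hE n hn).1 (P n) (hP n hn).1]
    rfl
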